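/- For every integer n ≥ 3 and every real w ≥ 1, one has v_{11}² − v_{12}² < 0, i.e. the squared first entry of a unit eigenvector for the largest eigenvalue of A(w) is strictly less than the squared first entry of a unit eigenvector for the second-largest eigenvalue of A(w). -/

import Mathlib

open Polynomial Real Filter

noncomputable def pathA (n : ℕ) (w : ℝ) : Matrix (Fin n) (Fin n) ℝ :=
  Matrix.of fun i j =>
    if i = j ∧ (i.val = 0 ∨ i.val = n - 1) then w
    else if i.val + 1 = j.val ∨ j.val + 1 = i.val then 1
    else 0

/-- `μ` lists the eigenvalues of `pathA n w` with multiplicity, in decreasing order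
(so `μ ⟨j-1,_⟩` is the `j`-th largest eigenvalue `λ_j(w)`). -/
def IsEigList (n : ℕ) (w : ℝ) (μ : Fin n → ℝ) : Prop :=
  Antitone μ ∧ (pathA n w).charpoly = ∏ i, (Polynomial.X - Polynomial.C (μ i))

/-- Two families on a finite type with the same multiset of values differ by a permutation. -/
lemma exists_perm_of_map_univ_eq {ι α : Type*} [Fintype ι] [DecidableEq α] {f g : ι → α}
    (h : (Finset.univ : Finset ι).val.map f = (Finset.univ : Finset ι).val.map g) :
    ∃ σ : Equiv.Perm ι, ∀ i, g (σ i) = f i := by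
  classical
  have key : ∀ a, Nonempty ({i // f i = a} ≃ {i // g i = a}) := fun a => by
    refine ⟨Fintype.equivOfCardEq ?_⟩
    have := congrArg (Multiset.count a) h
    rw [Multiset.count_map, Multiset.count_map] at this
    rw [Fintype.card_subtype, Fintype.card_subtype]
    simp only [eq_comm (b := a)]
    exact this
  exact ⟨Equiv.ofFiberEquiv fun a => (key a).some, fun i => Equiv.ofFiberEquiv_map _ i⟩

open Matrix in
/-- A real symmetric matrix has an orthonormal basis of eigenvectors, indexed according to any
given listing of the roots of its characteristic polynomial. -/
lemma exists_orthonormal_eigenvectors {n : ℕ} {A : Matrix (Fin n) (Fin n) ℝ} (hA : A.IsHermitian)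
    {μ : Fin n → ℝ} (hμ : A.charpoly = ∏ i, (X - C (μ i))) :
    ∃ c : Fin n → Fin n → ℝ, (∀ i, A *ᵥ c i = μ i • c i) ∧
      (∀ i j, c i ⬝ᵥ c j = if i = j then 1 else 0) ∧
      ∀ f : Fin n → ℝ, f = ∑ i, (c i ⬝ᵥ f) • c i := by
  classical
  have hroots : (Finset.univ : Finset (Fin n)).val.map μ =
      (Finset.univ : Finset (Fin n)).val.map hA.eigenvalues := by
    have h := congrArg Polynomial.roots (hμ.symm.trans hA.charpoly_eq)
    have aux (g : Fin n → ℝ) : (∏ i, (X - C (g i))).roots = Finset.univ.val.map g := by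
      rw [← Polynomial.roots_multiset_prod_X_sub_C (Finset.univ.val.map g), Multiset.map_map]
      rfl
    exact (aux μ).symm.trans (h.trans (aux hA.eigenvalues))
  obtain ⟨σ, hσ⟩ := exists_perm_of_map_univ_eq hroots
  have hinner (x y : EuclideanSpace ℝ (Fin n)) : inner ℝ x y = x.ofLp ⬝ᵥ y.ofLp := by
    rw [EuclideanSpace.inner_eq_star_dotProduct, dotProduct_comm]
    simp
  set b := hA.eigenvectorBasis.reindex σ.symm with hb
  refine ⟨fun i => (b i).ofLp, fun i => ?_, fun i j => ?_, fun f => ?_⟩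
  · simp only [hb, OrthonormalBasis.reindex_apply, Equiv.symm_symm]
    rw [hA.mulVec_eigenvectorBasis, hσ]
  · rw [← hinner]
    exact orthonormal_iff_ite.1 b.orthonormal i j
  · have h := congrArg WithLp.ofLp (b.sum_repr' (WithLp.toLp 2 f))
    simp only [hinner] at h
    rw [WithLp.ofLp_sum] at h
    simpa using h.symm

lemma pathA_isHermitian (n : ℕ) (w : ℝ) : (pathA n w).IsHermitian := by
  ext i j
  simp only [pathA, Matrix.conjTranspose_apply, Matrix.of_apply, star_trivial]
  have h1 : (j = i ∧ (j.val = 0 ∨ j.val = n - 1)) ↔ (i = j ∧ (i.val = 0 ∨ i.val = n - 1)) := by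
    constructor <;> rintro ⟨rfl, h⟩ <;> exact ⟨rfl, h⟩
  have h2 : (j.val + 1 = i.val ∨ i.val + 1 = j.val) ↔ (i.val + 1 = j.val ∨ j.val + 1 = i.val) :=
    or_comm
  simp only [h1, h2]

open Matrix in
/-- The action of `pathA` on a vector: loop term, left neighbour, right neighbour. -/
lemma pathA_mulVec_apply {n : ℕ} (w : ℝ) (f : Fin n → ℝ) (i : Fin n) :
    (pathA n w *ᵥ f) i = (if i.val = 0 ∨ i.val = n - 1 then w else 0) * f i
      + (if 0 < i.val then f ⟨i.val - 1, by omega⟩ else 0)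
      + (if h : i.val + 1 < n then f ⟨i.val + 1, h⟩ else 0) := by
  have hentry : ∀ j, pathA n w i j * f j =
      (if i = j then (if i.val = 0 ∨ i.val = n - 1 then w else 0) * f j else 0)
      + (if j.val + 1 = i.val then f j else 0) + (if i.val + 1 = j.val then f j else 0) := by
    intro j
    simp only [pathA, Matrix.of_apply]
    by_cases hij : i = j
    · subst hij
      simp
    · have : ¬ (i.val + 1 = j.val ∧ j.val + 1 = i.val) := by omega
      by_cases h1 : i.val + 1 = j.val
      · simp [hij, h1, show ¬ j.val + 1 = i.val by omega]
      · simp [hij, h1]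
  rw [Matrix.mulVec, dotProduct, Finset.sum_congr rfl fun j _ => hentry j,
    Finset.sum_add_distrib, Finset.sum_add_distrib, Finset.sum_ite_eq]
  simp only [Finset.mem_univ, if_true]
  congr 2
  · split_ifs with h
    · rw [Finset.sum_eq_single ⟨i.val - 1, by omega⟩]
      · exact if_pos (by simp only; omega)
      · intro j _ hj
        exact if_neg fun h' => hj (Fin.ext (by simp only; omega))
      · simp
    · exact Finset.sum_eq_zero fun j _ => if_neg (by omega)
  · split_ifs with h
    · rw [Finset.sum_eq_single ⟨i.val + 1, h⟩]
      · simp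
      · intro j _ hj
        rw [if_neg fun h' => hj (Fin.ext h'.symm)]
      · simp
    · exact Finset.sum_eq_zero fun j _ => if_neg (by omega)

open Matrix in
/-- First row of the eigenvalue equation. -/
lemma pathA_eigenvector_one {n : ℕ} {w lam : ℝ} {f : Fin n → ℝ}
    (hf : pathA n w *ᵥ f = lam • f) (h : 1 < n) :
    f ⟨1, h⟩ = (lam - w) * f ⟨0, by omega⟩ := by
  have h0 := congrFun hf ⟨0, by omega⟩
  rw [pathA_mulVec_apply] at h0
  simp only [true_or, if_true, lt_irrefl, if_false, zero_add, dif_pos h, Pi.smul_apply,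
    smul_eq_mul] at h0
  linarith

open Matrix in
/-- Interior rows of the eigenvalue equation. -/
lemma pathA_eigenvector_add_two {n : ℕ} {w lam : ℝ} {f : Fin n → ℝ}
    (hf : pathA n w *ᵥ f = lam • f) (j : ℕ) (h : j + 2 < n) :
    f ⟨j + 2, h⟩ = lam * f ⟨j + 1, by omega⟩ - f ⟨j, by omega⟩ := by
  have h0 := congrFun hf ⟨j + 1, by omega⟩
  rw [pathA_mulVec_apply] at h0
  have hne : ¬ (j + 1 = 0 ∨ j + 1 = n - 1) := by omega
  simp only [if_neg hne, zero_mul, zero_add, Nat.succ_pos, if_true, Nat.add_sub_cancel,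
    dif_pos h, Pi.smul_apply, smul_eq_mul, add_assoc, Nat.reduceAdd] at h0
  linarith

open Matrix in
/-- An eigenvector is determined by its first entry. -/
lemma pathA_eigenvector_eq_zero {n : ℕ} {w lam : ℝ} {f : Fin n → ℝ} (hn : 0 < n)
    (hf : pathA n w *ᵥ f = lam • f) (h0 : f ⟨0, hn⟩ = 0) : f = 0 := by
  have key : ∀ k, ∀ h : k < n, f ⟨k, h⟩ = 0 := by
    intro k
    induction k using Nat.strong_induction_on with
    | _ k ih =>
      intro h
      match k, ih, h with
      | 0, _, h => exact h0
      | 1, _, h => rw [pathA_eigenvector_one hf h, h0, mul_zero]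
      | j + 2, ih, h =>
        rw [pathA_eigenvector_add_two hf j h, ih (j + 1) (by omega), ih j (by omega)]
        ring
  funext i
  exact key i i.2

open Matrix in
lemma pathA_eigenvector_eq_smul {n : ℕ} {w lam : ℝ} {f y : Fin n → ℝ} (hn : 0 < n)
    (hf : pathA n w *ᵥ f = lam • f) (hy : pathA n w *ᵥ y = lam • y) (hy0 : y ⟨0, hn⟩ = 1) :
    f = f ⟨0, hn⟩ • y := by
  refine sub_eq_zero.1 (pathA_eigenvector_eq_zero (w := w) (lam := lam) hn ?_ ?_)
  · rw [mulVec_sub, mulVec_smul, hf, hy, smul_sub, smul_comm]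
  · simp [hy0]

open Matrix in
/-- `pathA` commutes with the reversal of the path. -/
lemma pathA_mulVec_rev {n : ℕ} (w : ℝ) (f : Fin n → ℝ) :
    pathA n w *ᵥ (fun i => f i.rev) = fun i => (pathA n w *ᵥ f) i.rev := by
  funext i
  simp only [mulVec, dotProduct]
  rw [← Equiv.sum_comp Fin.revPerm]
  refine Finset.sum_congr rfl fun j _ => ?_
  simp only [Fin.revPerm_apply, Fin.rev_rev]
  congr 1
  simp only [pathA, Matrix.of_apply, Fin.ext_iff, Fin.val_rev]
  have hi := i.2
  have hj := j.2
  congr 1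
  · simp only [eq_iff_iff]; omega
  · congr 1
    simp only [eq_iff_iff]; omega

open Matrix in
/-- Every eigenvector of `pathA` is symmetric or antisymmetric. -/
lemma pathA_eigenvector_rev {n : ℕ} {w lam : ℝ} {y : Fin n → ℝ} (hn : 0 < n)
    (hy : pathA n w *ᵥ y = lam • y) (hy0 : y ⟨0, hn⟩ = 1) :
    ∃ c : ℝ, c * c = 1 ∧ ∀ i, y i.rev = c * y i := by
  have hr : pathA n w *ᵥ (fun i => y i.rev) = lam • fun i => y i.rev := by
    rw [pathA_mulVec_rev, hy]
    rfl
  have h := pathA_eigenvector_eq_smul hn hr hy hy0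
  have h' : ∀ i, y i.rev = y (Fin.rev ⟨0, hn⟩) * y i := fun i => congrFun h i
  refine ⟨_, ?_, h'⟩
  rw [← h', Fin.rev_rev, hy0]

lemma exists_ne_zero_mul_add_mul_eq_zero (p q : ℝ) :
    ∃ a b : ℝ, (a ≠ 0 ∨ b ≠ 0) ∧ a * p + b * q = 0 := by
  by_cases hq : q = 0
  · exact ⟨0, 1, by simp, by simp [hq]⟩
  · exact ⟨q, -p, Or.inl hq, by ring⟩

open Matrix in
/-- If the quadratic form of `A - lam` is negative on the orthogonal complement of `v`, except
on eigenvectors, then the eigenvector for `lam` is nonnegative on the left half of the path. -/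
lemma pathA_eigenvector_left_nonneg {n : ℕ} {w lam : ℝ} {v y : Fin n → ℝ} (hn : 0 < n)
    (hy : pathA n w *ᵥ y = lam • y) (hy0 : y ⟨0, hn⟩ = 1)
    (H : ∀ f : Fin n → ℝ, v ⬝ᵥ f = 0 → 0 ≤ f ⬝ᵥ (pathA n w *ᵥ f - lam • f) →
      pathA n w *ᵥ f = lam • f) (k : ℕ) (hk : 2 * k + 1 ≤ n) :
    0 ≤ y ⟨k, by omega⟩ := by
  induction k using Nat.strong_induction_on with
  | _ k ih =>
    by_contra! hneg
    have hk0 : 0 < k := by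
      rcases Nat.eq_zero_or_pos k with rfl | h
      · rw [hy0] at hneg
        linarith
      · exact h
    have hprev : 0 ≤ y ⟨k - 1, by omega⟩ := ih (k - 1) (by omega) (by omega)
    obtain ⟨c, hc, hrev⟩ := pathA_eigenvector_rev hn hy hy0
    obtain ⟨a, b, hab, horth⟩ := exists_ne_zero_mul_add_mul_eq_zero
      (∑ i : Fin n, v i * if i.val < k then y i else 0)
      (∑ i : Fin n, v i * if n ≤ i.val + k then y i else 0)
    set g : ℕ → ℝ := fun i => if i < k then a else if n ≤ i + k then b else 0 with hg
    have gl : ∀ i, i < k → g i = a := fun i h => if_pos h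
    have gr : ∀ i, n ≤ i + k → g i = b := fun i h => by
      rw [hg]; simp only; rw [if_neg (by omega), if_pos h]
    have gm : ∀ i, k ≤ i → i + k < n → g i = 0 := fun i h h' => by
      rw [hg]; simp only; rw [if_neg (by omega), if_neg (by omega)]
    set f : Fin n → ℝ := fun i => g i.val * y i with hf
    have hvf : v ⬝ᵥ f = 0 := by
      rw [← horth, Finset.mul_sum, Finset.mul_sum, ← Finset.sum_add_distrib]
      refine Finset.sum_congr rfl fun i _ => ?_
      simp only [hf]
      rcases lt_or_ge i.val k with h | h
      · rw [gl _ h, if_pos h, if_neg (by omega)]; ring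
      · rcases lt_or_ge (i.val + k) n with h' | h'
        · rw [gm _ h h', if_neg (by omega), if_neg (by omega)]; ring
        · rw [gr _ h', if_neg (by omega), if_pos h']; ring
    have hdiff : ∀ i : Fin n, (pathA n w *ᵥ f) i - lam * f i =
        (if 0 < i.val then (g (i.val - 1) - g i.val) * y ⟨i.val - 1, by omega⟩ else 0) +
        (if h : i.val + 1 < n then (g (i.val + 1) - g i.val) * y ⟨i.val + 1, h⟩ else 0) := by
      intro i
      have hi := congrFun hy i
      rw [pathA_mulVec_apply, Pi.smul_apply, smul_eq_mul] at hi
      rw [pathA_mulVec_apply]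
      simp only [hf]
      rw [show lam * (g i.val * y i) = g i.val * (lam * y i) by ring, ← hi]
      by_cases h1 : 0 < i.val <;> by_cases h2 : i.val + 1 < n <;> simp only [h1, h2, if_true,
        if_false, dif_pos, dif_neg, not_false_eq_true] <;> ring
    have hQ : 0 ≤ f ⬝ᵥ (pathA n w *ᵥ f - lam • f) := by
      refine Finset.sum_nonneg fun i _ => ?_
      rw [Pi.sub_apply, Pi.smul_apply, smul_eq_mul, hdiff]
      simp only [hf]
      rcases lt_or_ge i.val k with h | h
      · have hz : (if 0 < i.val then
            (g (i.val - 1) - g i.val) * y ⟨i.val - 1, by omega⟩ else 0) = 0 := by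
          split_ifs
          · rw [gl _ h, gl _ (by omega)]; ring
          · rfl
        rw [hz, zero_add, dif_pos (by omega), gl _ h]
        rcases lt_or_ge (i.val + 1) k with h' | h'
        · rw [gl _ h']; simp
        · obtain ⟨i, hi⟩ := i
          obtain rfl : k = i + 1 := by simp only at h h'; omega
          rw [gm _ (by simp) (by simp only; omega)]
          simp only [Nat.add_sub_cancel] at hprev
          nlinarith [mul_nonneg (mul_nonneg (sq_nonneg a) hprev) (neg_nonneg.2 hneg.le)]
      · rcases lt_or_ge (i.val + k) n with h' | h'
        · rw [gm _ h h']; simp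
        · have hz : (if h : i.val + 1 < n then
              (g (i.val + 1) - g i.val) * y ⟨i.val + 1, h⟩ else 0) = 0 := by
            split_ifs
            · rw [gr _ h', gr _ (by omega)]; ring
            · rfl
          rw [hz, add_zero, if_pos (by omega), gr _ h']
          rcases le_or_gt n (i.val - 1 + k) with h'' | h''
          · rw [gr _ h'']; simp
          · rw [gm _ (by omega) h'']
            have e1 : i = Fin.rev ⟨k - 1, by omega⟩ := by
              ext; simp only [Fin.val_rev]; omega
            have e2 : (⟨i.val - 1, by omega⟩ : Fin n) = Fin.rev ⟨k, by omega⟩ := by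
              ext; simp only [Fin.val_rev]; omega
            rw [e2, hrev, show y i = c * y ⟨k - 1, by omega⟩ by rw [← hrev, ← e1]]
            have e3 : b * (c * y ⟨k - 1, by omega⟩) * ((0 - b) * (c * y ⟨k, by omega⟩)) =
                (c * c) * (b ^ 2 * y ⟨k - 1, by omega⟩ * -y ⟨k, by omega⟩) := by ring
            rw [e3, hc, one_mul]
            exact mul_nonneg (mul_nonneg (sq_nonneg b) hprev) (neg_nonneg.2 hneg.le)
    have hfy := pathA_eigenvector_eq_smul hn (H f hvf hQ) hy hy0
    have hfk := congrFun hfy ⟨k, by omega⟩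
    have hf0 : f ⟨0, hn⟩ = a := by simp only [hf]; rw [gl _ hk0, hy0, mul_one]
    rw [hf0] at hfy hfk
    have ha : a = 0 := by
      simp only [hf, Pi.smul_apply, smul_eq_mul] at hfk
      rw [gm _ le_rfl (by omega), zero_mul] at hfk
      exact (mul_eq_zero.1 hfk.symm).resolve_right hneg.ne
    have hb : b = 0 := by
      have h := congrFun hfy (Fin.rev ⟨0, hn⟩)
      simp only [hf, Pi.smul_apply, smul_eq_mul] at h
      rw [gr _ (by simp only [Fin.val_rev]; omega), hrev, hy0, ha] at h
      have hc0 : c ≠ 0 := by rintro rfl; simp at hc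
      simpa [hc0] using h
    exact hab.elim (· ha) (· hb)

open Matrix in
/-- Sturm comparison: as long as both eigenvectors stay nonnegative, the one for the larger
eigenvalue dominates, strictly beyond the first vertex. -/
lemma pathA_eigenvector_lt {n : ℕ} {w lam lam' : ℝ} {u y : Fin n → ℝ} (hn : 0 < n)
    (hlam : lam < lam') (hu : pathA n w *ᵥ u = lam' • u) (hy : pathA n w *ᵥ y = lam • y)
    (hu0 : u ⟨0, hn⟩ = 1) (hy0 : y ⟨0, hn⟩ = 1) {m : ℕ} (hm : m < n)
    (hupos : ∀ k, ∀ h : k ≤ m, 0 ≤ u ⟨k, by omega⟩)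
    (hypos : ∀ k, ∀ h : k ≤ m, 0 ≤ y ⟨k, by omega⟩) (k : ℕ) (hk : k + 1 ≤ m) :
    y ⟨k + 1, by omega⟩ < u ⟨k + 1, by omega⟩ ∧
      u ⟨k, by omega⟩ * y ⟨k + 1, by omega⟩ < u ⟨k + 1, by omega⟩ * y ⟨k, by omega⟩ := by
  induction k with
  | zero =>
    simp only [zero_add]
    rw [pathA_eigenvector_one hu, pathA_eigenvector_one hy, hu0, hy0]
    constructor <;> linarith
  | succ j ih =>
    obtain ⟨h1, h2⟩ := ih (by omega)
    have hu1 := hupos (j + 1) (by omega)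
    have hy1 := hypos (j + 1) (by omega)
    have hu2 := hupos (j + 2) (by omega)
    have hy2 := hypos (j + 2) (by omega)
    have eu := pathA_eigenvector_add_two hu j (by omega)
    have ey := pathA_eigenvector_add_two hy j (by omega)
    have hW : u ⟨j + 1, by omega⟩ * y ⟨j + 2, by omega⟩ <
        u ⟨j + 2, by omega⟩ * y ⟨j + 1, by omega⟩ := by
      rw [eu, ey]
      nlinarith [mul_nonneg (mul_nonneg hu1 hy1) (sub_nonneg.2 hlam.le)]
    refine ⟨?_, hW⟩
    by_contra! hle
    have := mul_le_mul h1.le hle hu2 hu1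
    linarith

open Matrix in
/-- On the orthogonal complement of the top eigenvector, the quadratic form of `A - lam` with
`lam` at least the second eigenvalue is nonpositive, and vanishes only on eigenvectors. -/
lemma mulVec_eq_smul_of_orthogonal {n : ℕ} {A : Matrix (Fin n) (Fin n) ℝ} {μ : Fin n → ℝ}
    {c : Fin n → Fin n → ℝ} (hc : ∀ i, A *ᵥ c i = μ i • c i)
    (hexp : ∀ f : Fin n → ℝ, f = ∑ i, (c i ⬝ᵥ f) • c i) {i₀ : Fin n} {lam : ℝ}
    (hlam : ∀ i, i ≠ i₀ → μ i ≤ lam) {f : Fin n → ℝ} (hf : c i₀ ⬝ᵥ f = 0)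
    (hQ : 0 ≤ f ⬝ᵥ (A *ᵥ f - lam • f)) : A *ᵥ f = lam • f := by
  have hsum : A *ᵥ f - lam • f = ∑ i, ((μ i - lam) * (c i ⬝ᵥ f)) • c i := by
    conv_lhs => rw [hexp f]
    rw [mulVec_sum, Finset.smul_sum, ← Finset.sum_sub_distrib]
    refine Finset.sum_congr rfl fun i _ => ?_
    rw [mulVec_smul, hc, smul_smul, smul_smul, ← sub_smul]
    ring_nf
  have hQ' : f ⬝ᵥ (A *ᵥ f - lam • f) = ∑ i, (μ i - lam) * (c i ⬝ᵥ f) ^ 2 := by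
    rw [hsum, dotProduct_sum]
    refine Finset.sum_congr rfl fun i _ => ?_
    rw [dotProduct_smul, dotProduct_comm f, smul_eq_mul]
    ring
  have hterm : ∀ i ∈ Finset.univ, (μ i - lam) * (c i ⬝ᵥ f) ^ 2 ≤ 0 := fun i _ => by
    by_cases hi : i = i₀
    · rw [hi, hf]; simp
    · exact mul_nonpos_of_nonpos_of_nonneg (sub_nonpos.2 (hlam i hi)) (sq_nonneg _)
  have hzero := (Finset.sum_eq_zero_iff_of_nonpos hterm).1
    (le_antisymm (Finset.sum_nonpos hterm) (hQ' ▸ hQ))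
  refine sub_eq_zero.1 (hsum.trans (Finset.sum_eq_zero fun i hi => ?_))
  have : (μ i - lam) * (c i ⬝ᵥ f) = 0 := by
    rcases mul_eq_zero.1 (hzero i hi) with h | h
    · rw [h, zero_mul]
    · rw [pow_eq_zero_iff two_ne_zero |>.1 h, mul_zero]
  rw [this, zero_smul]

open Matrix in
/-- A unit eigenvector can be normalized to have first entry `1`. -/
lemma pathA_eigenvector_normalize {n : ℕ} {w lam : ℝ} {v : Fin n → ℝ} (hn : 0 < n)
    (hunit : ∑ i, v i ^ 2 = 1) (hv : pathA n w *ᵥ v = lam • v) :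
    ∃ y : Fin n → ℝ, pathA n w *ᵥ y = lam • y ∧ y ⟨0, hn⟩ = 1 ∧
      v ⟨0, hn⟩ ^ 2 * ∑ i, y i ^ 2 = 1 := by
  have h0 : v ⟨0, hn⟩ ≠ 0 := fun h => by
    rw [pathA_eigenvector_eq_zero hn hv h] at hunit
    simp at hunit
  refine ⟨(v ⟨0, hn⟩)⁻¹ • v, ?_, by simp [h0], ?_⟩
  · rw [mulVec_smul, hv, smul_comm]
  · rw [← hunit, Finset.mul_sum]
    refine Finset.sum_congr rfl fun i _ => ?_
    simp only [Pi.smul_apply, smul_eq_mul]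
    field_simp

/-- For `n ≥ 3` and `w ≥ 1`, `v₁₁² − v₁₂² < 0`: the squared first entry of a unit
eigenvector for the largest eigenvalue is strictly less than that for the
second-largest eigenvalue. -/
theorem gap12 (n : ℕ) (hn : 3 ≤ n) (w : ℝ) (hw : 1 ≤ w)
    (μ : Fin n → ℝ) (hμ : IsEigList n w μ)
    (v1 v2 : Fin n → ℝ)
    (hv1unit : ∑ i, v1 i ^ 2 = 1)
    (hv1 : (pathA n w).mulVec v1 = μ ⟨0, by omega⟩ • v1)
    (hv2unit : ∑ i, v2 i ^ 2 = 1)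
    (hv2 : (pathA n w).mulVec v2 = μ ⟨1, by omega⟩ • v2) :
    v1 ⟨0, by omega⟩ ^ 2 - v2 ⟨0, by omega⟩ ^ 2 < 0 := by
  have hn0 : 0 < n := by omega
  obtain ⟨hanti, hchar⟩ := hμ
  obtain ⟨c, hc, horth, hexp⟩ := exists_orthonormal_eigenvectors (pathA_isHermitian n w) hchar
  obtain ⟨u, hu, hu0, hunorm⟩ := pathA_eigenvector_normalize hn0 hv1unit hv1
  obtain ⟨y, hy, hy0, hynorm⟩ := pathA_eigenvector_normalize hn0 hv2unit hv2
  have hle : μ ⟨1, by omega⟩ ≤ μ ⟨0, by omega⟩ := hanti (by simp [Fin.le_def])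
  have hlt : μ ⟨1, by omega⟩ < μ ⟨0, by omega⟩ := by
    refine lt_of_le_of_ne hle fun heq => ?_
    have e0 := pathA_eigenvector_eq_smul hn0 (hc ⟨0, by omega⟩) hu hu0
    have e1 := pathA_eigenvector_eq_smul hn0 (heq ▸ hc ⟨1, by omega⟩) hu hu0
    have h00 := horth ⟨0, by omega⟩ ⟨0, by omega⟩
    have h11 := horth ⟨1, by omega⟩ ⟨1, by omega⟩
    have h01 := horth ⟨0, by omega⟩ ⟨1, by omega⟩
    rw [if_pos rfl, e0, smul_dotProduct, dotProduct_smul, smul_eq_mul, smul_eq_mul] at h00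
    rw [if_pos rfl, e1, smul_dotProduct, dotProduct_smul, smul_eq_mul, smul_eq_mul] at h11
    rw [if_neg (by simp), e0, e1, smul_dotProduct, dotProduct_smul, smul_eq_mul,
      smul_eq_mul] at h01
    rcases mul_eq_zero.1 h01 with h | h
    · simp [h] at h00
    · rcases mul_eq_zero.1 h with h | h <;> simp [h] at h11
  have htail : ∀ i, i ≠ (⟨0, hn0⟩ : Fin n) → μ i ≤ μ ⟨1, by omega⟩ := fun i hi =>
    hanti (by
      have : i.val ≠ 0 := fun h => hi (Fin.ext h)
      rw [Fin.le_def]; simp only; omega)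
  have hupos := pathA_eigenvector_left_nonneg hn0 hu hu0 fun f hf hQ =>
    mulVec_eq_smul_of_orthogonal hc hexp (fun i hi => (htail i hi).trans hle) hf hQ
  have hypos := pathA_eigenvector_left_nonneg hn0 hy hy0 fun f hf hQ =>
    mulVec_eq_smul_of_orthogonal hc hexp htail hf hQ
  have hcmp := pathA_eigenvector_lt hn0 hlt hu hy hu0 hy0 (m := (n - 1) / 2) (by omega)
    (fun k hk => hupos k (by omega)) (fun k hk => hypos k (by omega))
  have hsq : ∀ k, ∀ hk : 2 * k + 1 ≤ n, y ⟨k, by omega⟩ ^ 2 ≤ u ⟨k, by omega⟩ ^ 2 := by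
    intro k hk
    refine pow_le_pow_left₀ (hypos k hk) ?_ 2
    cases k with
    | zero => rw [hu0, hy0]
    | succ k => exact (hcmp k (by omega)).1.le
  have hsq' : ∀ i : Fin n, y i ^ 2 ≤ u i ^ 2 := by
    intro i
    rcases le_or_gt (2 * i.val + 1) n with h | h
    · exact hsq i h
    · obtain ⟨a, ha, hra⟩ := pathA_eigenvector_rev hn0 hu hu0
      obtain ⟨b, hb, hrb⟩ := pathA_eigenvector_rev hn0 hy hy0
      have h' := hsq i.rev.val (by rw [Fin.val_rev]; omega)
      simp only [Fin.eta] at h'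
      rwa [hra, hrb, mul_pow, mul_pow, pow_two a, pow_two b, ha, hb, one_mul, one_mul] at h'
  have hsum : ∑ i, y i ^ 2 < ∑ i, u i ^ 2 :=
    Finset.sum_lt_sum (fun i _ => hsq' i) ⟨⟨1, by omega⟩, Finset.mem_univ _,
      pow_lt_pow_left₀ (hcmp 0 (by omega)).1 (hypos 1 (by omega)) two_ne_zero⟩
  have hynn : 0 ≤ ∑ i, y i ^ 2 := Finset.sum_nonneg fun i _ => sq_nonneg _
  by_contra! hge
  have h1 : 0 < v1 ⟨0, by omega⟩ ^ 2 := by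
    refine lt_of_le_of_ne (sq_nonneg _) fun h => ?_
    rw [← h, zero_mul] at hunorm
    exact zero_ne_one hunorm
  have h2 := mul_lt_mul_of_pos_left hsum h1
  have h3 := mul_le_mul_of_nonneg_right (sub_nonneg.1 hge) hynn
  linarith
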